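/- In any stable tree T of the tree connection game, every node u has at least indeg(u) − 1 children whose in-degree is at least (indeg(u) − 1)/2. -/

import Mathlib

open Function
open scoped ENNReal Classical

noncomputable section

namespace TCG

variable {n : ℕ}

/-- In-degree of node `v` in the network induced by profile `s` with root `r`:
the number of activated edges `(u, v)` with `u` an agent (a non-root node). -/
def indeg (r : Fin (n + 1)) (s : Fin (n + 1) → Fin (n + 1)) (v : Fin (n + 1)) : ℕ :=
  Nat.card {u : Fin (n + 1) | u ≠ r ∧ s u = v}

/-- `|T(u)|`: the number of nodes having a directed path to `u` (including `u` itself). -/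
def subtreeSize (s : Fin (n + 1) → Fin (n + 1)) (u : Fin (n + 1)) : ℕ :=
  Nat.card {w : Fin (n + 1) | ∃ k, s^[k] w = u}

/-- Cost of the agent at node `v` with respect to the root `r`:
the sum, over the edges `(u, u')` of the unique directed path from `v` to `r`,
of `indeg(u') / |T(u)|`; the cost is `∞` if no such path exists. -/
def cost (r : Fin (n + 1)) (s : Fin (n + 1) → Fin (n + 1)) (v : Fin (n + 1)) : ℝ≥0∞ :=
  if h : ∃ k, s^[k] v = r then
    ∑ k ∈ Finset.range (Nat.find h),
      (indeg r s (s^[k + 1] v) : ℝ≥0∞) / (subtreeSize s (s^[k] v) : ℝ≥0∞)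
  else ⊤

/-- A valid strategy profile: the root is absorbing (a formal convention encoding that the
root activates no edge), and every agent chooses a node different from herself. -/
def ValidProfile (r : Fin (n + 1)) (s : Fin (n + 1) → Fin (n + 1)) : Prop :=
  s r = r ∧ ∀ v, v ≠ r → s v ≠ v

/-- Pure Nash equilibrium (the induced network is *stable*): no agent can strictly
decrease her cost by unilaterally switching her activated edge to another node. -/
def IsStable (r : Fin (n + 1)) (s : Fin (n + 1) → Fin (n + 1)) : Prop :=
  ValidProfile r s ∧
    ∀ v, v ≠ r → ∀ w, w ≠ v → cost r s v ≤ cost r (Function.update s v w) v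

/-- Social cost: the sum of the costs of all agents (the non-root nodes). -/
def SC (s : Fin (n + 1) → Fin (n + 1)) : ℝ≥0∞ :=
  ∑ v ∈ Finset.univ.erase (0 : Fin (n + 1)), cost 0 s v

/-- Height of the induced network: the maximum length of a (leaf-to-)root path,
i.e. the least `k` such that every node arrives at the root after `k` steps. -/
def height (s : Fin (n + 1) → Fin (n + 1)) : ℕ :=
  sInf {k | ∀ v, s^[k] v = 0}

/-- Fairness Ratio: maximum agent cost divided by minimum agent cost. -/
def FR (s : Fin (n + 1) → Fin (n + 1)) : ℝ≥0∞ :=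
  (⨆ (v : Fin (n + 1)) (_ : v ≠ 0), cost 0 s v) /
    (⨅ (v : Fin (n + 1)) (_ : v ≠ 0), cost 0 s v)

theorem cost_of_ne_root {r : Fin (n + 1)} {s : Fin (n + 1) → Fin (n + 1)} {v : Fin (n + 1)}
    (hv : v ≠ r) (h : ∃ k, s^[k] (s v) = r) :
    cost r s v = (indeg r s (s v) : ℝ≥0∞) / subtreeSize s v + cost r s (s v) := by
  have h₁ : ∃ k, s^[k] v = r := by
    obtain ⟨k, hk⟩ := h
    exact ⟨k + 1, hk⟩
  have hfind : Nat.find h₁ = Nat.find h + 1 := Nat.find_comp_succ h₁ h hv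
  rw [cost, cost, dif_pos h₁, dif_pos h, hfind, Finset.sum_range_succ', add_comm]
  rfl

theorem subtreeSize_pos (s : Fin (n + 1) → Fin (n + 1)) (v : Fin (n + 1)) :
    0 < subtreeSize s v := by
  have : Nonempty {w : Fin (n + 1) | ∃ k, s^[k] w = v} := ⟨⟨v, 0, rfl⟩⟩
  exact Nat.card_pos

theorem cost_ne_top {r : Fin (n + 1)} {s : Fin (n + 1) → Fin (n + 1)} {v : Fin (n + 1)}
    (h : ∃ k, s^[k] v = r) : cost r s v ≠ ⊤ := by
  rw [cost, dif_pos h]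
  refine ENNReal.sum_ne_top.2 fun k _ => ENNReal.div_ne_top (ENNReal.natCast_ne_top _) ?_
  exact_mod_cast (subtreeSize_pos s _).ne'

/-- The only node on a directed cycle is the root. -/
theorem eq_zero_of_iterate_eq {s : Fin (n + 1) → Fin (n + 1)} (h0 : s 0 = 0)
    (htree : ∀ v, ∃ k, s^[k] v = 0) {a : Fin (n + 1)} {k : ℕ} (h : s^[k + 1] a = a) :
    a = 0 := by
  obtain ⟨m, hm⟩ := htree a
  have h₁ : s^[(k + 1) * m] a = a := (IsPeriodicPt.mul_const h m : IsPeriodicPt s _ a)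
  have h₂ : (k + 1) * m = k * m + m := by ring
  rw [h₂, iterate_add_apply, hm, iterate_fixed h0] at h₁
  exact h₁.symm

theorem reaches_update {s : Fin (n + 1) → Fin (n + 1)} {v w x : Fin (n + 1)}
    (hx : ∃ k, (update s v w)^[k] v = x) {a : Fin (n + 1)} (ha : ∃ k, s^[k] a = x) :
    ∃ k, (update s v w)^[k] a = x := by
  obtain ⟨k, hk⟩ := ha
  induction k generalizing a with
  | zero => exact ⟨0, hk⟩
  | succ k ih =>
    by_cases hav : a = v
    · exact hav ▸ hx
    · obtain ⟨m, hm⟩ := ih (a := s a) hk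
      exact ⟨m + 1, by rw [iterate_succ_apply, update_of_ne hav, hm]⟩

theorem subtreeSize_le_update {s : Fin (n + 1) → Fin (n + 1)} {v w x : Fin (n + 1)}
    (hx : ∃ k, (update s v w)^[k] v = x) :
    subtreeSize s x ≤ subtreeSize (update s v w) x :=
  Nat.card_mono (Set.toFinite _) fun _ ha => reaches_update hx ha

theorem indeg_update_le {r : Fin (n + 1)} {s : Fin (n + 1) → Fin (n + 1)} {v w x : Fin (n + 1)}
    (hx : x ≠ w) : indeg r (update s v w) x ≤ indeg r s x := by
  refine Nat.card_mono (Set.toFinite _) fun a ⟨ha, hax⟩ => ⟨ha, ?_⟩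
  by_cases hav : a = v
  · subst hav
    exact absurd (by simpa using hax.symm) hx
  · rwa [update_of_ne hav] at hax

theorem indeg_update_new_le {r : Fin (n + 1)} (s : Fin (n + 1) → Fin (n + 1))
    (v w : Fin (n + 1)) : indeg r (update s v w) w ≤ indeg r s w + 1 := by
  refine (Set.ncard_le_ncard (t := insert v {a | a ≠ r ∧ s a = w}) ?_ (Set.toFinite _)).trans
    (Set.ncard_insert_le _ _)
  rintro a ⟨ha, haw⟩
  by_cases hav : a = v
  · exact Or.inl hav
  · exact Or.inr ⟨ha, by rwa [update_of_ne hav] at haw⟩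

theorem indeg_update_old_lt {r : Fin (n + 1)} {s : Fin (n + 1) → Fin (n + 1)}
    {v w : Fin (n + 1)} (hv : v ≠ r) (hw : s v ≠ w) :
    indeg r (update s v w) (s v) < indeg r s (s v) := by
  refine Set.ncard_lt_ncard ?_ (Set.toFinite {a | a ≠ r ∧ s a = s v})
  refine (Set.ssubset_iff_of_subset ?_).2 ⟨v, ⟨hv, rfl⟩, ?_⟩
  · rintro a ⟨ha, hav'⟩
    by_cases hav : a = v
    · exact ⟨ha, by rw [hav]⟩
    · exact ⟨ha, by rwa [update_of_ne hav] at hav'⟩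
  · rintro ⟨-, h⟩
    exact hw (by simpa using h.symm)

theorem subtreeSize_add_le_update {s : Fin (n + 1) → Fin (n + 1)} (h0 : s 0 = 0)
    (htree : ∀ v, ∃ k, s^[k] v = 0) {v w : Fin (n + 1)} (hv : v ≠ 0) (hw : w ≠ 0)
    (hvw : v ≠ w) (hs : s v = s w) :
    subtreeSize s v + subtreeSize s w ≤ subtreeSize (update s v w) w := by
  have not_reach : ∀ {a b : Fin (n + 1)}, a ≠ b → b ≠ 0 → s a = s b → ∀ k, s^[k] a ≠ b := by
    intro a b hab hb hsab k hk
    cases k with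
    | zero => exact hab hk
    | succ k =>
      rw [iterate_succ_apply, hsab, ← iterate_succ_apply] at hk
      exact hb (eq_zero_of_iterate_eq h0 htree hk)
  have hdisj : Disjoint {a | ∃ k, s^[k] a = v} {a | ∃ k, s^[k] a = w} := by
    rw [Set.disjoint_left]
    rintro a ⟨k, hk⟩ ⟨l, hl⟩
    rcases le_total k l with h | h
    · obtain ⟨m, rfl⟩ := Nat.exists_eq_add_of_le' h
      rw [iterate_add_apply, hk] at hl
      exact not_reach hvw hw hs m hl
    · obtain ⟨m, rfl⟩ := Nat.exists_eq_add_of_le' h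
      rw [iterate_add_apply, hl] at hk
      exact not_reach hvw.symm hv hs.symm m hk
  have hstep : (update s v w)^[1] v = w := by simp
  refine (Set.ncard_union_eq hdisj (Set.toFinite _) (Set.toFinite _)).symm.trans_le
    (Set.ncard_le_ncard ?_ (Set.toFinite {a | ∃ k, (update s v w)^[k] a = w}))
  rintro a (ha | ha)
  · obtain ⟨k, hk⟩ := reaches_update (x := v) (w := w) ⟨0, rfl⟩ ha
    exact ⟨1 + k, by rw [iterate_add_apply, hk, hstep]⟩
  · exact reaches_update ⟨1, hstep⟩ ha

/-- When `v` moves from its parent to a sibling `w`, the iterates of the parent do not change. -/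
theorem iterate_update_parent {s : Fin (n + 1) → Fin (n + 1)} (h0 : s 0 = 0)
    (htree : ∀ v, ∃ k, s^[k] v = 0) {v : Fin (n + 1)} (hv : v ≠ 0) (w : Fin (n + 1)) (k : ℕ) :
    (update s v w)^[k] (s v) = s^[k] (s v) := by
  induction k with
  | zero => rfl
  | succ k ih =>
    rw [iterate_succ_apply', iterate_succ_apply', ih, update_of_ne]
    intro h
    exact hv (eq_zero_of_iterate_eq h0 htree h)

theorem cost_update_parent_le {s : Fin (n + 1) → Fin (n + 1)} (h0 : s 0 = 0)
    (htree : ∀ v, ∃ k, s^[k] v = 0) {v w : Fin (n + 1)} (hv : v ≠ 0) (hw : w ≠ 0)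
    (hvw : v ≠ w) (hs : s v = s w) :
    cost 0 (update s v w) (s v) ≤ cost 0 s (s v) := by
  have hit := iterate_update_parent h0 htree hv w
  simp only [cost, hit, htree, dite_true]
  refine Finset.sum_le_sum fun k _ => ENNReal.div_le_div ?_ ?_
  · refine Nat.cast_le.2 (indeg_update_le fun h => ?_)
    rw [hs] at h
    exact hw (eq_zero_of_iterate_eq (k := k + 1) h0 htree h)
  · refine Nat.cast_le.2 (subtreeSize_le_update ⟨k + 2, ?_⟩)
    rw [iterate_add_apply, ← hit k]
    simp [update_of_ne hvw.symm, hs]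

/-- The stability inequality for the deviation of `v` to a sibling `w`. -/
theorem IsStable.indeg_div_le {s : Fin (n + 1) → Fin (n + 1)} (hstable : IsStable 0 s)
    (htree : ∀ v, ∃ k, s^[k] v = 0) {v w : Fin (n + 1)} (hv : v ≠ 0) (hw : w ≠ 0)
    (hvw : v ≠ w) (hs : s v = s w) :
    (indeg 0 s (s v) : ℝ) / subtreeSize s v ≤
      ((indeg 0 s w : ℝ) + 1) / subtreeSize s v +
        ((indeg 0 s (s v) : ℝ) - 1) / (subtreeSize s v + subtreeSize s w) := by
  obtain ⟨⟨h0, hne⟩, hst⟩ := hstable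
  have hsw : s v ≠ w := hs ▸ hne w hw
  have hv' : update s v w v = w := update_self ..
  have hw' : update s v w w = s v := by rw [update_of_ne hvw.symm, hs]
  have hreach : ∃ k, (update s v w)^[k] (s v) = 0 := by
    simpa only [iterate_update_parent h0 htree hv w] using htree (s v)
  have hreach' : ∃ k, (update s v w)^[k] w = 0 := by
    obtain ⟨k, hk⟩ := hreach
    exact ⟨k + 1, by rw [iterate_succ_apply, hw', hk]⟩
  have hcost := hst v hv w hvw.symm
  rw [cost_of_ne_root hv (htree _),
    cost_of_ne_root (s := update s v w) hv (by rwa [hv']), hv',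
    cost_of_ne_root (s := update s v w) hw (by rwa [hw']), hw', ← add_assoc] at hcost
  have hlt := indeg_update_old_lt hv hsw
  have hcost' := (ENNReal.add_le_add_iff_right (cost_ne_top (htree _))).1
    (hcost.trans (add_le_add_right (cost_update_parent_le h0 htree hv hw hvw hs) _))
  have hpos := subtreeSize_pos (update s v w)
  have hcostR := ENNReal.toReal_mono (ENNReal.add_ne_top.2
    ⟨ENNReal.div_ne_top (ENNReal.natCast_ne_top _) (by exact_mod_cast (hpos v).ne'),
      ENNReal.div_ne_top (ENNReal.natCast_ne_top _) (by exact_mod_cast (hpos w).ne')⟩) hcost'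
  rw [ENNReal.toReal_add
    (ENNReal.div_ne_top (ENNReal.natCast_ne_top _) (by exact_mod_cast (hpos v).ne'))
    (ENNReal.div_ne_top (ENNReal.natCast_ne_top _) (by exact_mod_cast (hpos w).ne'))] at hcostR
  simp only [ENNReal.toReal_div, ENNReal.toReal_natCast] at hcostR
  have hposv : (0 : ℝ) < subtreeSize s v := by exact_mod_cast subtreeSize_pos s v
  have hposw : (0 : ℝ) < subtreeSize s w := by exact_mod_cast subtreeSize_pos s w
  have hlt' : (indeg 0 (update s v w) (s v) : ℝ) + 1 ≤ indeg 0 s (s v) := by exact_mod_cast hlt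
  refine hcostR.trans (add_le_add (div_le_div₀ (by positivity) ?_ hposv ?_)
    (div_le_div₀ ?_ (by linarith) (by positivity) ?_))
  · exact_mod_cast indeg_update_new_le s v w
  · exact_mod_cast subtreeSize_le_update ⟨0, rfl⟩
  · linarith [(indeg 0 (update s v w) (s v)).cast_nonneg (α := ℝ)]
  · exact_mod_cast subtreeSize_add_le_update h0 htree hv hw hvw hs

/-- A sibling of `v` whose subtree is at least as large has high in-degree. -/
theorem IsStable.half_le_indeg {s : Fin (n + 1) → Fin (n + 1)} (hstable : IsStable 0 s)
    (htree : ∀ v, ∃ k, s^[k] v = 0) {v w : Fin (n + 1)} (hv : v ≠ 0) (hw : w ≠ 0)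
    (hvw : v ≠ w) (hs : s v = s w) (hle : subtreeSize s v ≤ subtreeSize s w) :
    ((indeg 0 s (s v) : ℝ) - 1) / 2 ≤ indeg 0 s w := by
  have h := hstable.indeg_div_le htree hv hw hvw hs
  have hposv : (0 : ℝ) < subtreeSize s v := by exact_mod_cast subtreeSize_pos s v
  have hleR : (subtreeSize s v : ℝ) ≤ subtreeSize s w := by exact_mod_cast hle
  have hdeg : (1 : ℝ) ≤ indeg 0 s (s v) := by
    have : Nonempty {a : Fin (n + 1) | a ≠ 0 ∧ s a = s v} := ⟨⟨v, hv, rfl⟩⟩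
    exact_mod_cast (Nat.card_pos : 0 < Nat.card {a : Fin (n + 1) | a ≠ 0 ∧ s a = s v})
  have h₂ : ((indeg 0 s (s v) : ℝ) - 1) / (subtreeSize s v + subtreeSize s w) ≤
      (((indeg 0 s (s v) : ℝ) - 1) / 2) / subtreeSize s v := by
    rw [div_div]
    exact div_le_div_of_nonneg_left (by linarith) (by positivity) (by linarith)
  have h₃ := h.trans (add_le_add_right h₂ _)
  rw [← add_div, div_le_div_iff_of_pos_right hposv] at h₃
  linarith

/-- In any stable tree, every node `u` has at least `indeg(u) − 1`
children whose in-degree is at least `(indeg(u) − 1)/2`. -/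
theorem many_children_of_high_degree {n : ℕ} (s : Fin (n + 1) → Fin (n + 1))
    (hstable : IsStable 0 s) (htree : ∀ v, ∃ k, s^[k] v = 0)
    (u : Fin (n + 1)) :
    (indeg 0 s u : ℝ) - 1 ≤
      (Nat.card {w : Fin (n + 1) |
        w ≠ 0 ∧ s w = u ∧ ((indeg 0 s u : ℝ) - 1) / 2 ≤ (indeg 0 s w : ℝ)} : ℝ) := by
  rcases Set.eq_empty_or_nonempty {w : Fin (n + 1) | w ≠ 0 ∧ s w = u} with hC | hC
  · have hdeg : indeg 0 s u = 0 := by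
      rw [indeg, hC]
      simp
    rw [hdeg, Nat.cast_zero]
    linarith [(Nat.card {w : Fin (n + 1) |
      w ≠ 0 ∧ s w = u ∧ ((0 : ℝ) - 1) / 2 ≤ (indeg 0 s w : ℝ)}).cast_nonneg (α := ℝ)]
  · obtain ⟨v, ⟨hv, rfl⟩, hmin⟩ := Set.exists_min_image _ (subtreeSize s) (Set.toFinite _) hC
    rw [sub_le_iff_le_add, ← Nat.cast_add_one, Nat.cast_le]
    refine (Set.ncard_le_ncard (t := insert v {w : Fin (n + 1) |
      w ≠ 0 ∧ s w = s v ∧ ((indeg 0 s (s v) : ℝ) - 1) / 2 ≤ (indeg 0 s w : ℝ)}) ?_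
      (Set.toFinite _)).trans (Set.ncard_insert_le _ _)
    rintro w ⟨hw, hsw⟩
    by_cases hvw : w = v
    · exact Or.inl hvw
    · exact Or.inr ⟨hw, hsw, hstable.half_le_indeg htree hv hw (Ne.symm hvw) hsw.symm
        (hmin w ⟨hw, hsw⟩)⟩

end TCG
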